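/- arXiv:1905.10180 — 2 statements merged into one kernel-verified Lean document; each statement's English description precedes it below -/
import Mathlib

section
/- Let t ≥ 2, n₁, n₂ ≥ 1 and q ≥ 2 be integers, let Q be an alphabet of size q, let A ⊆ Q^{n₁} be a t-frameproof code, and let φ : Q → {0,1}^{n₂} be an injection whose image B = φ(Q) is a t-signature code of length n₂. Define Φ(a) = (φ(a(1)), φ(a(2)), …, φ(a(n₁))) ∈ {0,1}^{n₁n₂} for a ∈ A (concatenation of the blocks φ(a(i))). Then C = Φ(A) is a t-signature code of length n₁·n₂ with |C| = |A|. -/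
open Finset

/-- A binary code over index set `ι`: every coordinate of every codeword is 0 or 1. -/
def IsBinaryCode {ι : Type*} (C : Finset (ι → ℝ)) : Prop :=
  ∀ c ∈ C, ∀ i, c i = 0 ∨ c i = 1

/-- `C` is a `t`-signature code (codewords indexed by a finite set `ι`). -/
def IsSignatureCode {ι : Type*} [Fintype ι] (t : ℕ) (C : Finset (ι → ℝ)) : Prop :=
  ∀ C₁ ⊆ C, ∀ C₂ ⊆ C, C₁ ≠ C₂ →
    1 ≤ C₁.card → C₁.card ≤ t → 1 ≤ C₂.card → C₂.card ≤ t →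
    ∀ lam mu : (ι → ℝ) → ℝ,
      (∀ c ∈ C₁, 0 < lam c) → (∀ c ∈ C₂, 0 < mu c) →
      (∑ c ∈ C₁, lam c) = 1 → (∑ c ∈ C₂, mu c) = 1 →
      (∑ c ∈ C₁, lam c • c) ≠ (∑ c ∈ C₂, mu c • c)

/-- `A` is a `t`-frameproof code over the alphabet `Q`. -/
def IsFrameproofCode {Q : Type*} {m : ℕ} (t : ℕ) (A : Finset (Fin m → Q)) : Prop :=
  ∀ A₀ ⊆ A, 1 ≤ A₀.card → A₀.card ≤ t →
    ∀ a ∈ A, a ∉ A₀ → ∃ k : Fin m, ∀ x ∈ A₀, x k ≠ a k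

/-- Pushing the weights of a linear combination forward along a linear map. -/
lemma sum_image_fiber_smul {E F : Type*} [AddCommGroup E] [Module ℝ E] [AddCommGroup F]
    [Module ℝ F] [DecidableEq F] (π : E →ₗ[ℝ] F) (C : Finset E) (lam : E → ℝ) :
    ∑ d ∈ C.image π, (∑ c ∈ C with π c = d, lam c) • d = π (∑ c ∈ C, lam c • c) := by
  rw [map_sum, ← Finset.sum_fiberwise_of_maps_to
    (fun c hc => Finset.mem_image_of_mem π hc) (fun c => π (lam c • c))]
  refine Finset.sum_congr rfl fun d _ => ?_
  rw [Finset.sum_smul]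
  refine Finset.sum_congr rfl fun c hc => ?_
  rw [map_smul, (Finset.mem_filter.1 hc).2]

/-- Two positive convex combinations of at most `t` vectors that agree, and whose vectors are sent
into a `t`-signature code by a linear map, have supports with the same image. -/
lemma IsSignatureCode.image_eq_of_sum_eq {E ι : Type*} [Fintype ι] [AddCommGroup E] [Module ℝ E]
    {t : ℕ} {B : Finset (ι → ℝ)} (hB : IsSignatureCode t B) (π : E →ₗ[ℝ] (ι → ℝ))
    {C₁ C₂ : Finset E} (h₁B : C₁.image π ⊆ B) (h₂B : C₂.image π ⊆ B)
    (h₁ : 1 ≤ C₁.card) (h₁t : C₁.card ≤ t) (h₂ : 1 ≤ C₂.card) (h₂t : C₂.card ≤ t)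
    {lam mu : E → ℝ} (hlam : ∀ c ∈ C₁, 0 < lam c) (hmu : ∀ c ∈ C₂, 0 < mu c)
    (hlam1 : ∑ c ∈ C₁, lam c = 1) (hmu1 : ∑ c ∈ C₂, mu c = 1)
    (h : ∑ c ∈ C₁, lam c • c = ∑ c ∈ C₂, mu c • c) : C₁.image π = C₂.image π := by
  have card_pos : ∀ C : Finset E, 1 ≤ C.card → 1 ≤ (C.image π).card := fun C hC =>
    Finset.card_pos.2 ((Finset.card_pos.1 hC).image π)
  have weight_pos : ∀ (C : Finset E) (w : E → ℝ), (∀ c ∈ C, 0 < w c) →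
      ∀ d ∈ C.image π, 0 < ∑ c ∈ C with π c = d, w c := by
    intro C w hw d hd
    obtain ⟨c, hc, hcd⟩ := Finset.mem_image.1 hd
    exact Finset.sum_pos (fun x hx => hw x (Finset.mem_filter.1 hx).1)
      ⟨c, Finset.mem_filter.2 ⟨hc, hcd⟩⟩
  have weight_sum : ∀ (C : Finset E) (w : E → ℝ),
      ∑ d ∈ C.image π, ∑ c ∈ C with π c = d, w c = ∑ c ∈ C, w c := fun C w =>
    Finset.sum_fiberwise_of_maps_to (fun c hc => Finset.mem_image_of_mem π hc) w
  by_contra hne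
  refine hB _ h₁B _ h₂B hne (card_pos C₁ h₁) (Finset.card_image_le.trans h₁t)
    (card_pos C₂ h₂) (Finset.card_image_le.trans h₂t)
    (fun d => ∑ c ∈ C₁ with π c = d, lam c) (fun d => ∑ c ∈ C₂ with π c = d, mu c)
    (weight_pos C₁ lam hlam) (weight_pos C₂ mu hmu)
    ((weight_sum C₁ lam).trans hlam1) ((weight_sum C₂ mu).trans hmu1) ?_
  rw [sum_image_fiber_smul, sum_image_fiber_smul, h]

/-- A codeword of the concatenated code outside a set `C` of at most `t` codewords has a block
differing from the corresponding block of every member of `C`. -/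
lemma IsFrameproofCode.exists_block_notMem {Q κ : Type*} {t m : ℕ} {A : Finset (Fin m → Q)}
    (hA : IsFrameproofCode t A) {φ : Q → κ → ℝ} (hφ : Function.Injective φ)
    {C : Finset (Fin m × κ → ℝ)}
    (hC : ∀ c ∈ C, ∃ a ∈ A, (fun p : Fin m × κ => φ (a p.1) p.2) = c)
    (h : 1 ≤ C.card) (ht : C.card ≤ t) {a : Fin m → Q} (ha : a ∈ A)
    (haC : (fun p : Fin m × κ => φ (a p.1) p.2) ∉ C) :
    ∃ k, ∀ c ∈ C, (fun j => c (k, j)) ≠ φ (a k) := by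
  classical
  have : Nonempty (Fin m → Q) := ⟨a⟩
  choose! f hfA hf using hC
  obtain ⟨k, hk⟩ := hA (C.image f) (Finset.image_subset_iff.2 hfA)
    (Finset.card_pos.2 ((Finset.card_pos.1 h).image f)) (Finset.card_image_le.trans ht) a ha (by
      intro hmem
      obtain ⟨c, hc, rfl⟩ := Finset.mem_image.1 hmem
      exact haC ((hf c hc).symm ▸ hc))
  refine ⟨k, fun c hc hck => hk (f c) (Finset.mem_image_of_mem f hc) (hφ ?_)⟩
  rw [← hck]
  funext j
  exact congrFun (hf c hc) (k, j)

theorem stmt_16 {Q : Type*} [Fintype Q] [DecidableEq Q]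
    (t n₁ n₂ q : ℕ) (ht : 2 ≤ t) (hn₁ : 1 ≤ n₁) (hn₂ : 1 ≤ n₂) (hq : 2 ≤ q)
    (hQ : Fintype.card Q = q)
    (A : Finset (Fin n₁ → Q)) (hA : IsFrameproofCode t A)
    (φ : Q → (Fin n₂ → ℝ)) (hφ : Function.Injective φ)
    (hbin : ∀ x : Q, ∀ j, φ x j = 0 ∨ φ x j = 1)
    (hB : IsSignatureCode t (Finset.univ.image φ)) :
    IsSignatureCode t
        (A.image (fun a => fun p : Fin n₁ × Fin n₂ => φ (a p.1) p.2)) ∧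
      (A.image (fun a => fun p : Fin n₁ × Fin n₂ => φ (a p.1) p.2)).card = A.card := by
  refine ⟨?_, Finset.card_image_of_injective A fun a b hab =>
    funext fun k => hφ (funext fun j => congrFun hab (k, j))⟩
  intro C₁ hC₁ C₂ hC₂ hne h₁ h₁t h₂ h₂t lam mu hlam hmu hlam1 hmu1 hsum
  have block_mem : ∀ C ⊆ A.image (fun a => fun p : Fin n₁ × Fin n₂ => φ (a p.1) p.2), ∀ k,
      C.image (LinearMap.funLeft ℝ ℝ (Prod.mk k)) ⊆ Finset.univ.image φ := by
    intro C hC k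
    refine Finset.image_subset_iff.2 fun c hc => ?_
    obtain ⟨a, -, rfl⟩ := Finset.mem_image.1 (hC hc)
    exact Finset.mem_image_of_mem φ (Finset.mem_univ (a k))
  have image_eq : ∀ k, C₁.image (LinearMap.funLeft ℝ ℝ (Prod.mk k)) =
      C₂.image (LinearMap.funLeft ℝ ℝ (Prod.mk k)) := fun k =>
    hB.image_eq_of_sum_eq _ (block_mem C₁ hC₁ k) (block_mem C₂ hC₂ k) h₁ h₁t h₂ h₂t
      hlam hmu hlam1 hmu1 hsum
  have subset_of_image_eq :
      ∀ D ⊆ A.image (fun a => fun p : Fin n₁ × Fin n₂ => φ (a p.1) p.2),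
      ∀ C ⊆ A.image (fun a => fun p : Fin n₁ × Fin n₂ => φ (a p.1) p.2),
      1 ≤ C.card → C.card ≤ t →
      (∀ k, D.image (LinearMap.funLeft ℝ ℝ (Prod.mk k)) =
        C.image (LinearMap.funLeft ℝ ℝ (Prod.mk k))) → D ⊆ C := by
    intro D hD C hC h ht hDC c hcD
    by_contra hcC
    obtain ⟨a, ha, rfl⟩ := Finset.mem_image.1 (hD hcD)
    obtain ⟨k, hk⟩ := hA.exists_block_notMem hφ
      (fun c hc => Finset.mem_image.1 (hC hc)) h ht ha hcC
    have hmem := Finset.mem_image_of_mem (LinearMap.funLeft ℝ ℝ (Prod.mk k)) hcD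
    rw [hDC k] at hmem
    obtain ⟨c, hc, hck⟩ := Finset.mem_image.1 hmem
    exact hk c hc hck
  exact hne ((subset_of_image_eq C₁ hC₁ C₂ hC₂ h₂ h₂t image_eq).antisymm
    (subset_of_image_eq C₂ hC₂ C₁ hC₁ h₁ h₁t fun k => (image_eq k).symm))
end

section
/- Let t₁ > t₂ ≥ 2 and n₁, n₂ ≥ 1 be integers, let A ⊆ {0,1}^{n₁} be a t₁-superimposed code with codewords a₁, …, a_{M₁}, and let B ⊆ {0,1}^{n₂} be a t₂-signature code containing the all-zero vector 0. Set B* = B \ {0} and define C = {a_h ⊗ b : 1 ≤ h ≤ M₁, b ∈ B*} ⊆ {0,1}^{n₁n₂}, where (a ⊗ b)(i,j) = a(i)·b(j) for (i,j) ∈ {1,…,n₁}×{1,…,n₂}, partitioned into the M₁ groups G_h = {a_h ⊗ b : b ∈ B*}. Then C with this partition is a two-level (t₁,t₂)-signature code of length n₁·n₂. -/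
open Finset

/-- `A` is a `t`-superimposed code. -/
def IsSuperimposedCode {m : ℕ} (t : ℕ) (A : Finset (Fin m → ℝ)) : Prop :=
  ∀ A₀ ⊆ A, 1 ≤ A₀.card → A₀.card ≤ t →
    ∀ a ∈ A, a ∉ A₀ → ∃ k : Fin m, a k = 1 ∧ ∀ x ∈ A₀, x k = 0

/-- The set of groups (members of the partition `P`) met by `S`. -/
noncomputable def groupsOf {ι : Type*} [Fintype ι] (P : Finset (Finset (ι → ℝ)))
    (S : Finset (ι → ℝ)) : Finset (Finset (ι → ℝ)) :=
  P.filter (fun H => (S ∩ H).Nonempty)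

/-- `C`, together with the partition `P` into nonempty groups, is a two-level
`(t₁,t₂)`-signature code. -/
def IsTwoLevelSignatureCode {ι : Type*} [Fintype ι] (t₁ t₂ : ℕ)
    (C : Finset (ι → ℝ)) (P : Finset (Finset (ι → ℝ))) : Prop :=
  ∀ C₁ ⊆ C, ∀ C₂ ⊆ C,
    ∀ lam mu : (ι → ℝ) → ℝ,
      (∀ c ∈ C₁, 0 < lam c) → (∀ c ∈ C₂, 0 < mu c) →
      (∑ c ∈ C₁, lam c) = 1 → (∑ c ∈ C₂, mu c) = 1 →
      (∑ c ∈ C₁, lam c • c) = (∑ c ∈ C₂, mu c • c) →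
      ((1 ≤ C₁.card → C₁.card ≤ t₂ → 1 ≤ C₂.card → C₂.card ≤ t₂ → C₁ = C₂) ∧
       (1 ≤ C₁.card → C₁.card ≤ t₁ → 1 ≤ C₂.card → C₂.card ≤ t₁ →
         groupsOf P C₁ = groupsOf P C₂))

/-- The product word `a ⊗ b`. -/
def tensorWord {α β : Type*} (a : α → ℝ) (b : β → ℝ) : α × β → ℝ :=
  fun p => a p.1 * b p.2

/-- A signature code also identifies the support of a convex combination indexed by an arbitrary
family of codewords, possibly with repetitions. -/
lemma IsSignatureCode.image_eq_image {ι κ : Type*} [Fintype ι] {t : ℕ} {B : Finset (ι → ℝ)}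
    (hB : IsSignatureCode t B) (s : κ → ι → ℝ) {X Y : Finset κ}
    (hXB : ∀ x ∈ X, s x ∈ B) (hYB : ∀ y ∈ Y, s y ∈ B)
    (hX : 1 ≤ X.card) (hXt : X.card ≤ t) (hY : 1 ≤ Y.card) (hYt : Y.card ≤ t)
    {lam mu : κ → ℝ} (hlam : ∀ x ∈ X, 0 < lam x) (hmu : ∀ y ∈ Y, 0 < mu y)
    (hlam1 : ∑ x ∈ X, lam x = 1) (hmu1 : ∑ y ∈ Y, mu y = 1)
    (h : ∑ x ∈ X, lam x • s x = ∑ y ∈ Y, mu y • s y) :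
    X.image s = Y.image s := by
  have pos : ∀ (Z : Finset κ) (w : κ → ℝ), (∀ z ∈ Z, 0 < w z) →
      ∀ d ∈ Z.image s, 0 < ∑ z ∈ Z with s z = d, w z := by
    intro Z w hw d hd
    obtain ⟨z, hz, rfl⟩ := mem_image.1 hd
    exact sum_pos (fun y hy => hw y (mem_filter.1 hy).1) ⟨z, mem_filter.2 ⟨hz, rfl⟩⟩
  have total : ∀ (Z : Finset κ) (w : κ → ℝ),
      ∑ d ∈ Z.image s, ∑ z ∈ Z with s z = d, w z = ∑ z ∈ Z, w z := fun Z w =>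
    sum_fiberwise_of_maps_to (fun z hz => mem_image_of_mem s hz) w
  have combo : ∀ (Z : Finset κ) (w : κ → ℝ),
      ∑ d ∈ Z.image s, (∑ z ∈ Z with s z = d, w z) • d = ∑ z ∈ Z, w z • s z := by
    intro Z w
    rw [← sum_fiberwise_of_maps_to (fun z hz => mem_image_of_mem s hz) (fun z => w z • s z)]
    refine sum_congr rfl fun d _ => ?_
    rw [sum_smul]
    exact sum_congr rfl fun z hz => by rw [(mem_filter.1 hz).2]
  have card_pos' : ∀ Z : Finset κ, 1 ≤ Z.card → 1 ≤ (Z.image s).card := fun Z hZ =>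
    card_pos.2 ((card_pos.1 hZ).image s)
  by_contra hne
  refine hB (X.image s) (image_subset_iff.2 hXB) (Y.image s) (image_subset_iff.2 hYB) hne
    (card_pos' X hX) (card_image_le.trans hXt) (card_pos' Y hY) (card_image_le.trans hYt)
    (fun d => ∑ x ∈ X with s x = d, lam x) (fun d => ∑ y ∈ Y with s y = d, mu y)
    (pos X lam hlam) (pos Y mu hmu) ((total X lam).trans hlam1) ((total Y mu).trans hmu1) ?_
  rw [combo, combo, h]

/-- A nonzero word of a binary code has a coordinate equal to `1`. -/
lemma IsBinaryCode.exists_eq_one {ι : Type*} [Fintype ι] {B : Finset (ι → ℝ)}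
    (hB : IsBinaryCode B)
    {b : ι → ℝ} (hb : b ∈ B.erase 0) : ∃ j, b j = 1 := by
  obtain ⟨hb0, hbB⟩ := mem_erase.1 hb
  obtain ⟨j, hj⟩ := Function.ne_iff.1 hb0
  exact ⟨j, (hB b hbB j).resolve_left hj⟩

/-- The left factor of a product word is determined by the word. -/
lemma IsSuperimposedCode.eq_of_tensorWord_eq {m : ℕ} {ι : Type*} [Fintype ι] {t : ℕ} (ht : 1 ≤ t)
    {A : Finset (Fin m → ℝ)} (hA : IsSuperimposedCode t A)
    {B : Finset (ι → ℝ)} (hB : IsBinaryCode B)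
    {a a' : Fin m → ℝ} {b b' : ι → ℝ} (ha : a ∈ A) (ha' : a' ∈ A) (hb : b ∈ B.erase 0)
    (h : tensorWord a b = tensorWord a' b') : a = a' := by
  by_contra hne
  obtain ⟨k, hk, hk'⟩ := hA {a'} (by simpa using ha') (by simp) (by simpa using ht) a ha
    (by simpa using hne)
  obtain ⟨j, hj⟩ := hB.exists_eq_one hb
  have := congrFun h (k, j)
  simp [tensorWord, hk, hj, hk' a' (mem_singleton_self a')] at this

section ProductCode

variable {m : ℕ} {ι : Type*} [Fintype ι] {t : ℕ} {A : Finset (Fin m → ℝ)} {B : Finset (ι → ℝ)}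
  {C₁ C₂ : Finset (Fin m × ι → ℝ)} {lam mu : (Fin m × ι → ℝ) → ℝ}

/-- Equal positive combinations of product words involve the same left factors. -/
lemma IsSuperimposedCode.exists_tensorWord_mem (hA : IsSuperimposedCode t A)
    (hAbin : IsBinaryCode A) (hBbin : IsBinaryCode B)
    (h₁ : ∀ c ∈ C₁, ∃ a ∈ A, ∃ b ∈ B.erase 0, tensorWord a b = c)
    (h₂ : ∀ c ∈ C₂, ∃ a ∈ A, ∃ b ∈ B.erase 0, tensorWord a b = c)
    (hC₂ : 1 ≤ C₂.card) (hC₂t : C₂.card ≤ t) (hlam : ∀ c ∈ C₁, 0 < lam c)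
    (heq : ∑ c ∈ C₁, lam c • c = ∑ c ∈ C₂, mu c • c)
    {a : Fin m → ℝ} {b : ι → ℝ} (ha : a ∈ A) (hb : b ∈ B.erase 0)
    (hab : tensorWord a b ∈ C₁) :
    ∃ b' ∈ B.erase 0, tensorWord a b' ∈ C₂ := by
  choose! f hf g hg hfg using h₂
  by_cases haf : a ∈ C₂.image f
  · obtain ⟨c, hc, rfl⟩ := mem_image.1 haf
    exact ⟨g c, hg c hc, by rwa [hfg c hc]⟩
  exfalso
  obtain ⟨k, hk, hk'⟩ := hA (C₂.image f) (image_subset_iff.2 hf)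
    (card_pos.2 ((card_pos.1 hC₂).image f)) (card_image_le.trans hC₂t) a ha haf
  obtain ⟨j, hj⟩ := hBbin.exists_eq_one hb
  have hkj := congrFun heq (k, j)
  simp only [Finset.sum_apply, Pi.smul_apply, smul_eq_mul] at hkj
  have hzero : ∑ c ∈ C₂, mu c * c (k, j) = 0 := by
    refine sum_eq_zero fun c hc => ?_
    have : c (k, j) = f c k * g c j := (congrFun (hfg c hc) (k, j)).symm
    rw [this, hk' _ (mem_image_of_mem f hc)]
    simp
  have hpos : 0 < ∑ c ∈ C₁, lam c * c (k, j) := by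
    refine sum_pos' (fun c hc => mul_nonneg (hlam c hc).le ?_) ⟨_, hab, ?_⟩
    · obtain ⟨a', ha', b', hb', rfl⟩ := h₁ c hc
      rcases hAbin a' ha' k with h | h <;>
        rcases hBbin b' (mem_of_mem_erase hb') j with h' | h' <;> simp [tensorWord, h, h']
    · simpa [tensorWord, hk, hj] using hlam _ hab
  linarith

/-- Equal convex combinations of few product words have the same support. -/
lemma IsSuperimposedCode.tensorWord_subset {s : ℕ} (hst : s ≤ t)
    (hA : IsSuperimposedCode t A) (hAbin : IsBinaryCode A) (hBbin : IsBinaryCode B)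
    (hB : IsSignatureCode s B) (h0 : (0 : ι → ℝ) ∈ B)
    (h₁ : ∀ c ∈ C₁, ∃ a ∈ A, ∃ b ∈ B.erase 0, tensorWord a b = c)
    (h₂ : ∀ c ∈ C₂, ∃ a ∈ A, ∃ b ∈ B.erase 0, tensorWord a b = c)
    (hC₁ : 1 ≤ C₁.card) (hC₁s : C₁.card ≤ s) (hC₂ : 1 ≤ C₂.card) (hC₂s : C₂.card ≤ s)
    (hlam : ∀ c ∈ C₁, 0 < lam c) (hmu : ∀ c ∈ C₂, 0 < mu c)
    (hlam1 : ∑ c ∈ C₁, lam c = 1) (hmu1 : ∑ c ∈ C₂, mu c = 1)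
    (heq : ∑ c ∈ C₁, lam c • c = ∑ c ∈ C₂, mu c • c) : C₁ ⊆ C₂ := by
  intro c₀ hc₀
  obtain ⟨a, ha, b, hb, rfl⟩ := h₁ c₀ hc₀
  obtain ⟨b₂, hb₂, hab₂⟩ := hA.exists_tensorWord_mem hAbin hBbin h₁ h₂ hC₂ (hC₂s.trans hst)
    hlam heq ha hb hc₀
  by_cases ha0 : a = 0
  · have : tensorWord a b = tensorWord a b₂ := by ext p; simp [tensorWord, ha0]
    rwa [this]
  have hinj : ∀ {a a' : Fin m → ℝ} {b b' : ι → ℝ}, a ∈ A → a' ∈ A → b ∈ B.erase 0 →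
      tensorWord a b = tensorWord a' b' → a = a' := fun ha ha' hb h =>
    hA.eq_of_tensorWord_eq (hC₁.trans (hC₁s.trans hst)) hBbin ha ha' hb h
  obtain ⟨k, hk, hk₁⟩ : ∃ k, a k = 1 ∧ ∀ a' ∈ A, a' ≠ a → ∀ b' ∈ B.erase 0,
      tensorWord a' b' ∈ C₁ → a' k = 0 := by
    have h₁' := h₁
    choose! f hf g hg hfg using h₁'
    have hfmem : ∀ a' ∈ A, a' ≠ a → ∀ b' ∈ B.erase 0, tensorWord a' b' ∈ C₁ →
        a' ∈ (C₁.image f).erase a := fun a' ha' hne b' hb' hmem =>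
      mem_erase.2 ⟨hne, mem_image.2 ⟨_, hmem,
        hinj (hf _ hmem) ha' (hg _ hmem) (hfg _ hmem)⟩⟩
    rcases ((C₁.image f).erase a).eq_empty_or_nonempty with he | hne
    · obtain ⟨k, hk⟩ := Function.ne_iff.1 ha0
      refine ⟨k, (hAbin a ha k).resolve_left hk, fun a' ha' hne b' hb' hmem => ?_⟩
      have := hfmem a' ha' hne b' hb' hmem
      simp [he] at this
    · obtain ⟨k, hk, hk'⟩ := hA ((C₁.image f).erase a)
        ((erase_subset _ _).trans (image_subset_iff.2 hf)) (card_pos.2 hne)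
        ((card_le_card (erase_subset _ _)).trans (card_image_le.trans (hC₁s.trans hst)))
        a ha (notMem_erase _ _)
      exact ⟨k, hk, fun a' ha' hne b' hb' hmem => hk' _ (hfmem a' ha' hne b' hb' hmem)⟩
  have hk₂ : ∀ a' ∈ A, a' ≠ a → ∀ b' ∈ B.erase 0, tensorWord a' b' ∈ C₂ → a' k = 0 := by
    intro a' ha' hne b' hb' hmem
    obtain ⟨b'', hb'', hmem'⟩ := hA.exists_tensorWord_mem hAbin hBbin h₂ h₁ hC₁
      (hC₁s.trans hst) hmu heq.symm ha' hb' hmem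
    exact hk₁ a' ha' hne b'' hb'' hmem'
  let slice : (Fin m × ι → ℝ) → ι → ℝ := fun c j => c (k, j)
  have slice_self : ∀ b' : ι → ℝ, slice (tensorWord a b') = b' := by
    intro b'; ext j; simp [slice, tensorWord, hk]
  have slice_zero : ∀ (a' : Fin m → ℝ) (b' : ι → ℝ), a' k = 0 →
      slice (tensorWord a' b') = 0 := by
    intro a' b' h; ext j; simp [slice, tensorWord, h]
  have slice_mem : ∀ C : Finset (Fin m × ι → ℝ),
      (∀ c ∈ C, ∃ a ∈ A, ∃ b ∈ B.erase 0, tensorWord a b = c) →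
      (∀ a' ∈ A, a' ≠ a → ∀ b' ∈ B.erase 0, tensorWord a' b' ∈ C → a' k = 0) →
      ∀ c ∈ C, slice c ∈ B := by
    intro C hC hCk c hc
    obtain ⟨a', ha', b', hb', rfl⟩ := hC c hc
    by_cases h : a' = a
    · rw [h, slice_self]
      exact mem_of_mem_erase hb'
    · rwa [slice_zero _ _ (hCk a' ha' h b' hb' hc)]
  have himage := hB.image_eq_image slice (slice_mem C₁ h₁ hk₁) (slice_mem C₂ h₂ hk₂)
    hC₁ hC₁s hC₂ hC₂s hlam hmu hlam1 hmu1 (by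
      ext j
      simpa [slice] using congrFun heq (k, j))
  have hbmem : b ∈ C₂.image slice := by
    rw [← himage]
    exact mem_image.2 ⟨_, hc₀, slice_self b⟩
  obtain ⟨c, hc, hcb⟩ := mem_image.1 hbmem
  obtain ⟨a', ha', b', hb', rfl⟩ := h₂ c hc
  by_cases h : a' = a
  · rw [h, slice_self] at hcb
    rwa [h, hcb] at hc
  · rw [slice_zero _ _ (hk₂ a' ha' h b' hb' hc)] at hcb
    exact absurd hcb.symm (ne_of_mem_erase hb)

end ProductCode

theorem stmt_19 (t₁ t₂ n₁ n₂ : ℕ) (ht₂ : 2 ≤ t₂) (ht : t₂ < t₁)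
    (hn₁ : 1 ≤ n₁) (hn₂ : 1 ≤ n₂)
    (A : Finset (Fin n₁ → ℝ)) (hAbin : IsBinaryCode A)
    (hA : IsSuperimposedCode t₁ A)
    (B : Finset (Fin n₂ → ℝ)) (hBbin : IsBinaryCode B)
    (hB : IsSignatureCode t₂ B) (h0 : (0 : Fin n₂ → ℝ) ∈ B) :
    IsTwoLevelSignatureCode t₁ t₂
      ((A ×ˢ (B.erase 0)).image
        (fun ab => fun p : Fin n₁ × Fin n₂ => ab.1 p.1 * ab.2 p.2))
      (A.image (fun a =>
        (B.erase 0).image (fun b => fun p : Fin n₁ × Fin n₂ => a p.1 * b p.2))) := by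
  intro C₁ hC₁ C₂ hC₂ lam mu hlam hmu hlam1 hmu1 heq
  have decomp : ∀ C ⊆ (A ×ˢ (B.erase 0)).image
        (fun ab => fun p : Fin n₁ × Fin n₂ => ab.1 p.1 * ab.2 p.2),
      ∀ c ∈ C, ∃ a ∈ A, ∃ b ∈ B.erase 0, tensorWord a b = c := by
    intro C hC c hc
    obtain ⟨⟨a, b⟩, hab, rfl⟩ := mem_image.1 (hC hc)
    exact ⟨a, (mem_product.1 hab).1, b, (mem_product.1 hab).2, rfl⟩
  have h₁ := decomp C₁ hC₁
  have h₂ := decomp C₂ hC₂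
  refine ⟨fun c₁ c₁t c₂ c₂t => Subset.antisymm ?_ ?_, fun c₁ c₁t c₂ c₂t => ?_⟩
  · exact hA.tensorWord_subset ht.le hAbin hBbin hB h0 h₁ h₂ c₁ c₁t c₂ c₂t
      hlam hmu hlam1 hmu1 heq
  · exact hA.tensorWord_subset ht.le hAbin hBbin hB h0 h₂ h₁ c₂ c₂t c₁ c₁t
      hmu hlam hmu1 hlam1 heq.symm
  · refine filter_congr fun H hH => ?_
    obtain ⟨a, ha, rfl⟩ := mem_image.1 hH
    constructor
    · rintro ⟨c, hc⟩
      obtain ⟨hcC, hcH⟩ := mem_inter.1 hc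
      obtain ⟨b, hb, rfl⟩ := mem_image.1 hcH
      obtain ⟨b', hb', hmem⟩ := hA.exists_tensorWord_mem hAbin hBbin h₁ h₂ c₂ c₂t hlam heq
        ha hb hcC
      exact ⟨_, mem_inter.2 ⟨hmem, mem_image.2 ⟨b', hb', rfl⟩⟩⟩
    · rintro ⟨c, hc⟩
      obtain ⟨hcC, hcH⟩ := mem_inter.1 hc
      obtain ⟨b, hb, rfl⟩ := mem_image.1 hcH
      obtain ⟨b', hb', hmem⟩ := hA.exists_tensorWord_mem hAbin hBbin h₂ h₁ c₁ c₁t hmu heq.symm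
        ha hb hcC
      exact ⟨_, mem_inter.2 ⟨hmem, mem_image.2 ⟨b', hb', rfl⟩⟩⟩
end
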